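/- arXiv:1312.2857 — 4 statements merged into one kernel-verified Lean document; each statement's English description precedes it below -/
import Mathlib

section
/- Let G be a group acting on a proper metric space E (a metric space in which all closed balls are compact) by isometries, with the action free and properly discontinuous, and let p : E → E/G be the quotient map. Suppose φₙ → φ in the space C([0,1], E/G) of continuous paths with the compact-open topology, and suppose γₙ, γ : [0,1] → E are lifts (p ∘ γₙ = φₙ and p ∘ γ = φ) whose starting points converge: γₙ(0) → γ(0) in E. Then γₙ → γ uniformly on [0,1]. -/
open Pointwise

open Filter Topology

/-- A free properly discontinuous action moves each point by a distance bounded below. -/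
lemma exists_pos_le_dist_smul {G E : Type*} [Group G] [MetricSpace E] [MulAction G E]
    (hfree : ∀ (g : G) (x : E), g • x = x → g = 1)
    (hpd : ∀ x y : E, ∃ U ∈ nhds x, ∃ V ∈ nhds y,
      {g : G | ((g • U) ∩ V).Nonempty}.Finite) (x : E) :
    ∃ r > 0, ∀ g : G, g ≠ 1 → r ≤ dist (g • x) x := by
  obtain ⟨U, hU, V, hV, hfin⟩ := hpd x x
  have hev : ∀ᶠ y in 𝓝 x, ∀ g ∈ {g : G | ((g • U) ∩ V).Nonempty}, g ≠ 1 → y ≠ g • x := by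
    refine (eventually_all_finite hfin).2 fun g _ ↦ ?_
    by_cases hg : g = 1
    · simp [hg]
    · filter_upwards [isOpen_ne.mem_nhds fun h : x = g • x ↦ hg (hfree g x h.symm)]
        with y hy _ using hy
  have hmem : ∀ᶠ y in 𝓝 x, ∀ g : G, g ≠ 1 → y ≠ g • x := by
    filter_upwards [hev, hV] with y hy hyV g hg h
    exact hy g ⟨y, h ▸ Set.smul_mem_smul_set (mem_of_mem_nhds hU), hyV⟩ hg h
  obtain ⟨r, hr, hball⟩ := Metric.eventually_nhds_iff.1 hmem
  exact ⟨r, hr, fun g hg ↦ not_lt.1 fun h ↦ hball h g hg rfl⟩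

/-- A free properly discontinuous isometric action moves the points of a compact set by a distance
uniformly bounded below. -/
lemma IsCompact.exists_pos_le_dist_smul {G E : Type*} [Group G] [MetricSpace E] [MulAction G E]
    (hiso : ∀ g : G, Isometry (fun x : E => g • x))
    (hfree : ∀ (g : G) (x : E), g • x = x → g = 1)
    (hpd : ∀ x y : E, ∃ U ∈ nhds x, ∃ V ∈ nhds y,
      {g : G | ((g • U) ∩ V).Nonempty}.Finite) {K : Set E} (hK : IsCompact K) :
    ∃ r > 0, ∀ x ∈ K, ∀ g : G, g ≠ 1 → r ≤ dist (g • x) x := by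
  refine hK.induction_on (p := fun s ↦ ∃ r > 0, ∀ x ∈ s, ∀ g : G, g ≠ 1 → r ≤ dist (g • x) x)
    ⟨1, one_pos, by simp⟩ ?_ ?_ ?_
  · rintro s t hst ⟨r, hr, h⟩
    exact ⟨r, hr, fun x hx ↦ h x (hst hx)⟩
  · rintro s t ⟨r, hr, h⟩ ⟨r', hr', h'⟩
    refine ⟨min r r', lt_min hr hr', ?_⟩
    rintro x (hx | hx) g hg
    · exact (min_le_left _ _).trans (h x hx g hg)
    · exact (min_le_right _ _).trans (h' x hx g hg)
  · intro x _
    obtain ⟨r, hr, h⟩ := _root_.exists_pos_le_dist_smul hfree hpd x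
    refine ⟨Metric.ball x (r / 3),
      mem_nhdsWithin_of_mem_nhds (Metric.ball_mem_nhds x (by positivity)),
      r / 3, by positivity, fun y hy g hg ↦ ?_⟩
    have h₁ := h g hg
    have h₂ : dist (g • x) (g • y) = dist x y := (hiso g).dist_eq x y
    have h₃ := dist_triangle4 (g • x) (g • y) y x
    rw [Metric.mem_ball] at hy
    rw [h₂, dist_comm x y] at h₃
    linarith

/-- If the projection to the orbit space of a map `γ₀` is approximated in the compact-open
topology, then every value of the approximating map has a representative near `γ₀`. -/
lemma eventually_forall_exists_mk_eq_dist_lt {G E X : Type*} [Group G] [MetricSpace E]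
    [MulAction G E] [ContinuousConstSMul G E] [TopologicalSpace X] [CompactSpace X]
    [LocallyCompactSpace X]
    (φ₀ : C(X, Quotient (MulAction.orbitRel G E))) (γ₀ : C(X, E))
    (hlift₀ : ∀ t, Quotient.mk (MulAction.orbitRel G E) (γ₀ t) = φ₀ t) {ε : ℝ} (hε : 0 < ε) :
    ∀ᶠ f in 𝓝 φ₀, ∀ t, ∃ x, Quotient.mk (MulAction.orbitRel G E) x = f t ∧ dist x (γ₀ t) < ε := by
  have hopen : IsOpenMap (Quotient.mk (MulAction.orbitRel G E)) :=
    isOpenMap_quotient_mk'_mul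
  have hW : IsOpen (Prod.map id (Quotient.mk (MulAction.orbitRel G E)) ''
      {z : X × E | dist z.2 (γ₀ z.1) < ε}) :=
    (IsOpenMap.id.prodMap hopen) _ (isOpen_lt (by fun_prop) continuous_const)
  have := isCompact_univ.eventually_forall_of_forall_eventually (x₀ := φ₀)
    (P := fun f t ↦ ∃ x, Quotient.mk (MulAction.orbitRel G E) x = f t ∧ dist x (γ₀ t) < ε)
    fun t _ ↦ by
      have hc : Continuous fun z : C(X, Quotient (MulAction.orbitRel G E)) × X ↦ (z.2, z.1 z.2) :=
        by fun_prop
      filter_upwards [hc.continuousAt.preimage_mem_nhds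
        (hW.mem_nhds ⟨(t, γ₀ t), by simpa using hε, by simp [hlift₀]⟩)]
      rintro ⟨f, s⟩ ⟨⟨s', x⟩, hx, heq⟩
      obtain ⟨rfl, hx'⟩ := Prod.ext_iff.1 heq
      exact ⟨x, hx', hx⟩
  simpa using this

/-- **Convergence of lifts.**
`G` acts on a proper metric space `E` (all closed balls compact) by isometries,
freely and properly discontinuously; `p : E → E/G` is the orbit map.  If
`φₙ → φ` in `C([0,1], E/G)` (compact-open topology) and `γₙ, γ` are lifts of
`φₙ, φ` whose starting points satisfy `γₙ(0) → γ(0)`, then `γₙ → γ` uniformly. -/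
theorem lifts_tendstoUniformly
    {G E : Type*} [Group G] [MetricSpace E] [ProperSpace E] [MulAction G E]
    (hiso : ∀ g : G, Isometry (fun x : E => g • x))
    (hfree : ∀ (g : G) (x : E), g • x = x → g = 1)
    (hpd : ∀ x y : E, ∃ U ∈ nhds x, ∃ V ∈ nhds y,
      {g : G | ((g • U) ∩ V).Nonempty}.Finite)
    (φ : ℕ → C(unitInterval, Quotient (MulAction.orbitRel G E)))
    (φ₀ : C(unitInterval, Quotient (MulAction.orbitRel G E)))
    (hφ : Filter.Tendsto φ Filter.atTop (nhds φ₀))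
    (γ : ℕ → C(unitInterval, E)) (γ₀ : C(unitInterval, E))
    (hlift : ∀ (n : ℕ) (t : unitInterval),
      Quotient.mk (MulAction.orbitRel G E) (γ n t) = φ n t)
    (hlift₀ : ∀ t : unitInterval,
      Quotient.mk (MulAction.orbitRel G E) (γ₀ t) = φ₀ t)
    (hstart : Filter.Tendsto (fun n => γ n 0) Filter.atTop (nhds (γ₀ 0))) :
    TendstoUniformly (fun n => ⇑(γ n)) (⇑γ₀) Filter.atTop := by
  have : ContinuousConstSMul G E := ⟨fun g ↦ (hiso g).continuous⟩
  obtain ⟨r, hr, hmove⟩ :=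
    (isCompact_range γ₀.continuous).exists_pos_le_dist_smul hiso hfree hpd
  rw [Metric.tendstoUniformly_iff]
  intro ε hε
  obtain ⟨δ, hδ, hδε, hδr⟩ : ∃ δ > 0, δ ≤ ε ∧ 2 * δ ≤ r :=
    ⟨min ε (r / 2), lt_min hε (half_pos hr), min_le_left _ _,
      by linarith [min_le_right ε (r / 2)]⟩
  filter_upwards [hφ.eventually (eventually_forall_exists_mk_eq_dist_lt φ₀ γ₀ hlift₀ hδ),
    Metric.tendsto_nhds.1 hstart δ hδ] with n hn hn₀
  have hlt : ∀ t, dist (γ n t) (γ₀ t) ≤ δ → dist (γ n t) (γ₀ t) < δ := by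
    intro t ht
    obtain ⟨x, hx, hxt⟩ := hn t
    obtain ⟨g, rfl⟩ : x ∈ MulAction.orbit G (γ n t) :=
      Quotient.exact (hx.trans (hlift n t).symm)
    by_cases hg : g = 1
    · simpa [hg] using hxt
    · have h₁ := hmove (γ₀ t) ⟨t, rfl⟩ g hg
      have h₂ : dist (g • γ₀ t) (g • γ n t) = dist (γ₀ t) (γ n t) := (hiso g).dist_eq _ _
      have h₃ := dist_triangle (g • γ₀ t) (g • γ n t) (γ₀ t)
      rw [h₂, dist_comm (γ₀ t)] at h₃
      dsimp only at hxt
      linarith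
  have hclopen : IsClopen {t | dist (γ n t) (γ₀ t) < δ} := by
    refine ⟨?_, isOpen_lt (by fun_prop) continuous_const⟩
    convert isClosed_le (f := fun t ↦ dist (γ n t) (γ₀ t)) (g := fun _ ↦ δ)
      (by fun_prop) continuous_const using 1
    exact Set.Subset.antisymm (fun t (ht : dist (γ n t) (γ₀ t) < δ) ↦ ht.le) hlt
  intro t
  have ht : t ∈ {t | dist (γ n t) (γ₀ t) < δ} := by
    rw [hclopen.eq_univ ⟨0, hn₀⟩]
    trivial
  rw [dist_comm]
  exact lt_of_lt_of_le ht hδε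
end

section
/- Let G be a group acting on a proper metric space E (all closed balls compact) by isometries, with the action free and properly discontinuous, and let p : E → E/G be the quotient map. Define Ψ : C([0,1], E/G) → ℝ by Ψ(φ) = diam γ([0,1]), where γ : [0,1] → E is any lift of φ (i.e., p ∘ γ = φ); this value is independent of the choice of lift. Then Ψ is a continuous function on C([0,1], E/G) equipped with the compact-open topology. -/
open Pointwise

/-- A continuous action is properly discontinuous as soon as any two points have neighbourhoods
that are matched by only finitely many group elements. -/
theorem properlyDiscontinuousSMul_of_forall_exists_nhds {G E : Type*} [Group G]
    [TopologicalSpace E] [MulAction G E]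
    (h : ∀ x y : E, ∃ U ∈ nhds x, ∃ V ∈ nhds y, {g : G | ((g • U) ∩ V).Nonempty}.Finite) :
    ProperlyDiscontinuousSMul G E where
  finite_disjoint_inter_image {K L} hK hL := by
    have key : {g : G | ∃ q ∈ K ×ˢ L, g • q.1 = q.2}.Finite := by
      refine (hK.prod hL).induction_on (p := fun s ↦ {g : G | ∃ q ∈ s, g • q.1 = q.2}.Finite)
        (by simp) (fun s t hst ht ↦ ht.subset ?_) (fun s t hs ht ↦ (hs.union ht).subset ?_) ?_
      · rintro g ⟨q, hq, h⟩
        exact ⟨q, hst hq, h⟩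
      · rintro g ⟨q, hq | hq, h⟩
        · exact Or.inl ⟨q, hq, h⟩
        · exact Or.inr ⟨q, hq, h⟩
      · rintro ⟨x, y⟩ -
        obtain ⟨U, hU, V, hV, hfin⟩ := h x y
        refine ⟨U ×ˢ V, mem_nhdsWithin_of_mem_nhds (prod_mem_nhds hU hV), hfin.subset ?_⟩
        rintro g ⟨q, hq, h⟩
        exact ⟨q.2, ⟨q.1, hq.1, h⟩, hq.2⟩
    refine key.subset fun g hg ↦ ?_
    obtain ⟨_, ⟨x, hx, rfl⟩, hy⟩ := hg
    exact ⟨(x, g • x), ⟨hx, hy⟩, rfl⟩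

theorem ContinuousMap.diam_range_le_add_dist {α E : Type*} [TopologicalSpace α] [CompactSpace α]
    [PseudoMetricSpace E] (f g : C(α, E)) :
    Metric.diam (Set.range f) ≤ Metric.diam (Set.range g) + 2 * dist f g := by
  refine Metric.diam_le_of_forall_dist_le (by positivity) ?_
  rintro _ ⟨s, rfl⟩ _ ⟨t, rfl⟩
  have hg := Metric.dist_le_diam_of_mem (isCompact_range g.continuous).isBounded
    (Set.mem_range_self s) (Set.mem_range_self t)
  have hs := f.dist_apply_le_dist (g := g) s
  have ht := f.dist_apply_le_dist (g := g) t
  have := dist_triangle4_right (f s) (f t) (g s) (g t)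
  linarith

theorem ContinuousMap.continuous_diam_range {α E : Type*} [TopologicalSpace α] [CompactSpace α]
    [PseudoMetricSpace E] : Continuous fun f : C(α, E) ↦ Metric.diam (Set.range f) :=
  (LipschitzWith.of_le_add_mul 2 fun f g ↦ f.diam_range_le_add_dist g).continuous

/-- Paths in the base of a surjective covering map lift continuously near any given path. -/
theorem IsCoveringMap.exists_continuous_local_path_lift {E X : Type*} [TopologicalSpace E]
    [TopologicalSpace X] {p : E → X} (hp : IsCoveringMap p) (hsurj : Function.Surjective p)
    (φ : C(unitInterval, X)) :
    ∃ N ∈ nhds φ, ∃ L : N → C(unitInterval, E), Continuous L ∧ ∀ ψ t, p (L ψ t) = ψ.1 t := by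
  obtain ⟨e, he⟩ := hsurj (φ 0)
  obtain ⟨h, heh, rfl⟩ := hp.isLocalHomeomorph e
  let N : Set C(unitInterval, X) := {ψ | ψ 0 ∈ h.target}
  have hN : IsOpen N := h.open_target.preimage (continuous_eval_const 0)
  let f : C(N, E) := ⟨fun ψ ↦ h.symm (ψ.1 0), h.continuousOn_symm.comp_continuous
    ((continuous_eval_const 0).comp continuous_subtype_val) fun ψ ↦ ψ.2⟩
  let H : C(unitInterval × N, X) := ⟨fun q ↦ q.2.1 q.1, by fun_prop⟩
  have H_0 : ∀ ψ : N, H (0, ψ) = h (f ψ) := fun ψ ↦ (h.right_inv ψ.2).symm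
  let F := hp.liftHomotopy H f H_0
  refine ⟨N, hN.mem_nhds (show φ 0 ∈ h.target from he ▸ h.map_source heh),
    (F.comp ContinuousMap.prodSwap).curry, ContinuousMap.continuous _, fun ψ t ↦ ?_⟩
  exact congrFun (hp.liftHomotopy_lifts H f H_0) (t, ψ)

/-- **Continuity of the lifted-diameter function Ψ.**
`G` acts on a proper metric space `E` (all closed balls compact) by isometries,
freely and properly discontinuously; `p : E → E/G` is the orbit map.  The
function `Ψ : C([0,1], E/G) → ℝ` given by `Ψ(φ) = diam (γ([0,1]))`, where `γ`
is any lift of `φ` to `E` (a value independent of the choice of lift), is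
continuous for the compact-open topology on `C([0,1], E/G)`. -/
theorem psi_continuous
    {G E : Type*} [Group G] [MetricSpace E] [ProperSpace E] [MulAction G E]
    (hiso : ∀ g : G, Isometry (fun x : E => g • x))
    (hfree : ∀ (g : G) (x : E), g • x = x → g = 1)
    (hpd : ∀ x y : E, ∃ U ∈ nhds x, ∃ V ∈ nhds y,
      {g : G | ((g • U) ∩ V).Nonempty}.Finite)
    (Ψ : C(unitInterval, Quotient (MulAction.orbitRel G E)) → ℝ)
    (hΨ : ∀ (φ : C(unitInterval, Quotient (MulAction.orbitRel G E)))
      (γ : C(unitInterval, E)),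
      (∀ t : unitInterval, Quotient.mk (MulAction.orbitRel G E) (γ t) = φ t) →
      Ψ φ = Metric.diam (Set.range γ)) :
    Continuous Ψ := by
  have : ContinuousConstSMul G E := ⟨fun g ↦ (hiso g).continuous⟩
  have : ProperlyDiscontinuousSMul G E := properlyDiscontinuousSMul_of_forall_exists_nhds hpd
  have : IsCancelSMul G E := isCancelSMul_iff_eq_one_of_smul_eq.mpr hfree
  have hp := isQuotientCoveringMap_quotientMk_of_properlyDiscontinuousSMul (G := G) (E := E)
  refine continuous_iff_continuousAt.mpr fun φ ↦ ?_
  obtain ⟨N, hN, L, hL, hlift⟩ :=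
    hp.isCoveringMap.exists_continuous_local_path_lift hp.surjective φ
  refine ContinuousOn.continuousAt (s := N) (continuousOn_iff_continuous_domRestrict.mpr ?_) hN
  exact (ContinuousMap.continuous_diam_range.comp hL).congr fun ψ ↦ (hΨ ψ (L ψ) (hlift ψ)).symm
end

section
/- Let Z be a topological space, L a compact metric space, and λ ≥ 0. Suppose H : Z × [0,1] → L is a continuous map such that for every z ∈ Z the path t ↦ H(z, t) is λ-Lipschitz. Then there exists a continuous map H̄ : βZ × [0,1] → L on the Stone–Čech compactification βZ of Z such that H̄(η(z), t) = H(z, t) for all z ∈ Z and t ∈ [0,1], where η : Z → βZ is the canonical map. Moreover, if A ⊆ L is closed and H(z, 1) ∈ A for all z ∈ Z, then H̄(ζ, 1) ∈ A for all ζ ∈ βZ. -/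
/-- **Extension of equi-Lipschitz homotopies to the Stone–Čech compactification.**
Let `Z` be a topological space, `L` a compact metric space and `λ ≥ 0`.  If
`H : Z × [0,1] → L` is continuous and every track `t ↦ H(z,t)` is `λ`-Lipschitz,
then `H` extends to a continuous `H̄ : βZ × [0,1] → L` with
`H̄(η z, t) = H(z, t)`, where `η : Z → βZ` is the canonical map.  Moreover, if a
closed set `A ⊆ L` contains `H(z,1)` for all `z`, then `H̄(ζ,1) ∈ A` for all
`ζ ∈ βZ`. -/
theorem stoneCech_extension_of_equiLipschitz_homotopy
    {Z L : Type*} [TopologicalSpace Z] [MetricSpace L] [CompactSpace L]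
    (lam : ℝ) (hlam : 0 ≤ lam)
    (H : Z × unitInterval → L) (hH : Continuous H)
    (hLip : ∀ (z : Z) (s t : unitInterval),
      dist (H (z, s)) (H (z, t)) ≤ lam * dist s t) :
    ∃ Hbar : StoneCech Z × unitInterval → L, Continuous Hbar ∧
      (∀ (z : Z) (t : unitInterval), Hbar (stoneCechUnit z, t) = H (z, t)) ∧
      ∀ A : Set L, IsClosed A → (∀ z : Z, H (z, 1) ∈ A) →
        ∀ ζ : StoneCech Z, Hbar (ζ, 1) ∈ A := by
  have hcont (t : unitInterval) : Continuous fun z ↦ H (z, t) := by fun_prop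
  have hext (z : Z) (t : unitInterval) :
      stoneCechExtend (hcont t) (stoneCechUnit z) = H (z, t) :=
    stoneCechExtend_stoneCechUnit (hcont t) z
  refine ⟨fun p ↦ stoneCechExtend (hcont p.2) p.1, ?_, hext, fun A hA hHA ζ ↦ ?_⟩
  · refine continuous_prod_of_continuous_lipschitzWith' _ lam.toNNReal
      (fun ζ ↦ LipschitzWith.of_dist_le_mul fun s t ↦ ?_)
      fun t ↦ continuous_stoneCechExtend (hcont t)
    induction ζ using denseRange_stoneCechUnit.induction_on with
    | hp =>
      exact isClosed_le ((continuous_stoneCechExtend (hcont s)).dist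
        (continuous_stoneCechExtend (hcont t))) continuous_const
    | ih z => simpa only [hext, Real.coe_toNNReal lam hlam] using hLip z s t
  · induction ζ using denseRange_stoneCechUnit.induction_on with
    | hp => exact hA.preimage (continuous_stoneCechExtend (hcont 1))
    | ih z => simpa only [hext] using hHA z
end

section
/- Under the hypotheses that G is a group acting on a proper metric space E by isometries, freely and properly discontinuously, with quotient covering map p : E → X = E/G, the following holds: for every topological space Z and every continuous map Ĥ : βZ × [0,1] → X (where βZ is the Stone–Čech compactification of Z with canonical map η : Z → βZ), there is a constant C such that for every z ∈ Z and every lift γ : [0,1] → E of the path t ↦ Ĥ(η(z), t) (i.e., p ∘ γ(t) = Ĥ(η(z), t)), one has diam γ([0,1]) ≤ C. -/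
open Pointwise

open Filter Topology

/-- A point of a free, properly discontinuous action is uniformly far from its other translates. -/
theorem exists_pos_le_dist_smul_of_properlyDiscontinuous
    {G E : Type*} [Group G] [MetricSpace E] [MulAction G E]
    (hfree : ∀ (g : G) (x : E), g • x = x → g = 1)
    (hpd : ∀ x y : E, ∃ U ∈ 𝓝 x, ∃ V ∈ 𝓝 y, {g : G | ((g • U) ∩ V).Nonempty}.Finite)
    (x : E) : ∃ r > 0, ∀ g : G, g ≠ 1 → r ≤ dist x (g • x) := by
  obtain ⟨U, hU, V, hV, hfin⟩ := hpd x x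
  have hsmall : ∀ᶠ r in 𝓝[>] (0 : ℝ), ∀ g ∈ {g : G | ((g • U) ∩ V).Nonempty},
      g ≠ 1 → r ≤ dist x (g • x) := by
    rw [eventually_all_finite hfin]
    intro g _
    by_cases hg : g = 1
    · simp [hg]
    · have hd : 0 < dist x (g • x) := dist_pos.2 fun h => hg (hfree g x h.symm)
      filter_upwards [Ioc_mem_nhdsGT hd] with r hr _ using hr.2
  obtain ⟨ε, hε, hεV⟩ := Metric.mem_nhds_iff.1 hV
  obtain ⟨r, hr, hr0, hrε⟩ := (hsmall.and (Ioc_mem_nhdsGT hε)).exists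
  refine ⟨r, hr0, fun g hg => ?_⟩
  by_contra! hlt
  have hgV : g • x ∈ V := hεV (by rw [Metric.mem_ball, dist_comm]; linarith)
  exact hlt.not_ge (hr g ⟨g • x, Set.smul_mem_smul_set (mem_of_mem_nhds hU), hgV⟩ hg)

/-- If the translates of `x` are `r`-separated, a preconnected set covered by the balls of radius
`r / 2` about them lies in one of these balls, so its points are at distance at most `r`. -/
theorem dist_le_of_isPreconnected_of_forall_mem_ball_smul
    {G E : Type*} [Group G] [MetricSpace E] [MulAction G E]
    (hiso : ∀ g : G, Isometry (fun x : E => g • x)) {x : E} {r : ℝ}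
    (hr : ∀ g : G, g ≠ 1 → r ≤ dist x (g • x)) {S : Set E} (hS : IsPreconnected S)
    (hcov : ∀ y ∈ S, ∃ g : G, y ∈ Metric.ball (g • x) (r / 2)) {y y' : E}
    (hy : y ∈ S) (hy' : y' ∈ S) : dist y y' ≤ r := by
  obtain ⟨g, hg⟩ := hcov y hy
  have hdisj : Disjoint (Metric.ball (g • x) (r / 2))
      (⋃ h ∈ {h : G | h ≠ g}, Metric.ball (h • x) (r / 2)) := by
    simp only [Set.disjoint_iUnion_right]
    intro h hne
    apply Metric.ball_disjoint_ball
    have hd : dist (g • x) (h • x) = dist x ((g⁻¹ * h) • x) := by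
      rw [← (hiso g).dist_eq x, smul_smul, mul_inv_cancel_left]
    rw [hd, add_halves]
    exact hr _ fun h1 => hne (inv_mul_eq_one.1 h1).symm
  have hsub : S ⊆ Metric.ball (g • x) (r / 2) := by
    refine hS.subset_left_of_subset_union Metric.isOpen_ball
      (isOpen_biUnion fun _ _ => Metric.isOpen_ball) hdisj (fun w hw => ?_) ⟨y, hy, hg⟩
    obtain ⟨h, hh⟩ := hcov w hw
    by_cases hgh : h = g
    · exact Or.inl (hgh ▸ hh)
    · exact Or.inr (Set.mem_biUnion (t := fun h : G => Metric.ball (h • x) (r / 2)) hgh hh)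
  have h₁ := Metric.mem_ball.1 (hsub hy)
  have h₂ := Metric.mem_ball.1 (hsub hy')
  have h₃ := dist_triangle_right y y' (g • x)
  linarith

/-- Lifts of nearby tracks of a homotopy to an orbit space have small oscillation near a given
time. -/
theorem exists_dist_lift_le_eventually
    {G E : Type*} [Group G] [MetricSpace E] [MulAction G E]
    (hiso : ∀ g : G, Isometry (fun x : E => g • x))
    (hfree : ∀ (g : G) (x : E), g • x = x → g = 1)
    (hpd : ∀ x y : E, ∃ U ∈ 𝓝 x, ∃ V ∈ 𝓝 y, {g : G | ((g • U) ∩ V).Nonempty}.Finite)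
    {B T : Type*} [TopologicalSpace B] [TopologicalSpace T] [LocallyConnectedSpace T]
    {H : B × T → Quotient (MulAction.orbitRel G E)} (hH : Continuous H) (b : B) (t : T) :
    ∃ C : ℝ, ∃ J ∈ 𝓝 t, ∀ᶠ b' in 𝓝 b, ∀ γ : C(T, E),
      (∀ s, Quotient.mk (MulAction.orbitRel G E) (γ s) = H (b', s)) →
      ∀ s ∈ J, ∀ s' ∈ J, dist (γ s) (γ s') ≤ C := by
  have : ContinuousConstSMul G E := ⟨fun g => (hiso g).continuous⟩
  obtain ⟨x, hx⟩ := Quotient.exists_rep (H (b, t))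
  obtain ⟨r, hr0, hr⟩ := exists_pos_le_dist_smul_of_properlyDiscontinuous hfree hpd x
  have hopen : IsOpen (Quotient.mk (MulAction.orbitRel G E) '' Metric.ball x (r / 2)) :=
    isOpenMap_quotient_mk'_mul _ Metric.isOpen_ball
  have hmem : H ⁻¹' (Quotient.mk (MulAction.orbitRel G E) '' Metric.ball x (r / 2)) ∈ 𝓝 (b, t) :=
    (hopen.preimage hH).mem_nhds ⟨x, Metric.mem_ball_self (half_pos hr0), hx⟩
  obtain ⟨W, hW, J, hJ, hWJ⟩ := mem_nhds_prod_iff.1 hmem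
  obtain ⟨K, hK, hKc, hKJ⟩ := locallyConnectedSpace_iff_connected_subsets.1 ‹_› t J hJ
  refine ⟨r, K, hK, ?_⟩
  filter_upwards [hW] with b' hb' γ hγ s hs s' hs'
  refine dist_le_of_isPreconnected_of_forall_mem_ball_smul hiso hr
    (hKc.image γ γ.continuous.continuousOn) ?_ (Set.mem_image_of_mem γ hs)
    (Set.mem_image_of_mem γ hs')
  rintro _ ⟨u, hu, rfl⟩
  obtain ⟨y, hy, hyu⟩ := hWJ (Set.mk_mem_prod hb' (hKJ hu))
  rw [← hγ u] at hyu
  obtain ⟨g, hg⟩ := MulAction.orbitRel_apply.1 (Quotient.exact hyu.symm)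
  refine ⟨g, ?_⟩
  rw [Metric.mem_ball, ← hg]
  exact ((hiso g).dist_eq y x).trans_lt hy

/-- Lifts of the tracks of a homotopy, parametrised by a compact space, to an orbit space have
uniformly bounded image. -/
theorem exists_dist_lift_le
    {G E : Type*} [Group G] [MetricSpace E] [MulAction G E]
    (hiso : ∀ g : G, Isometry (fun x : E => g • x))
    (hfree : ∀ (g : G) (x : E), g • x = x → g = 1)
    (hpd : ∀ x y : E, ∃ U ∈ 𝓝 x, ∃ V ∈ 𝓝 y, {g : G | ((g • U) ∩ V).Nonempty}.Finite)
    {B T : Type*} [TopologicalSpace B] [CompactSpace B] [TopologicalSpace T] [CompactSpace T]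
    [PreconnectedSpace T] [LocallyConnectedSpace T]
    {H : B × T → Quotient (MulAction.orbitRel G E)} (hH : Continuous H) :
    ∃ C : ℝ, ∀ (b : B) (γ : C(T, E)),
      (∀ s, Quotient.mk (MulAction.orbitRel G E) (γ s) = H (b, s)) →
      ∀ s s', dist (γ s) (γ s') ≤ C := by
  let Lift (b : B) (γ : C(T, E)) : Prop :=
    ∀ s, Quotient.mk (MulAction.orbitRel G E) (γ s) = H (b, s)
  have hloc (b : B) (t : T) : ∃ C : ℝ, ∃ J ∈ 𝓝 t, ∀ᶠ b' in 𝓝 b, ∀ γ, Lift b' γ →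
      ∀ s ∈ J, ∀ s' ∈ J, dist (γ s) (γ s') ≤ C :=
    exists_dist_lift_le_eventually hiso hfree hpd hH b t
  have hpair (b : B) (s t : T) : ∃ C : ℝ, ∀ᶠ b' in 𝓝 b, ∀ γ, Lift b' γ →
      dist (γ s) (γ t) ≤ C := by
    refine isPreconnected_univ.induction₂
      (fun s t => ∃ C : ℝ, ∀ᶠ b' in 𝓝 b, ∀ γ, Lift b' γ → dist (γ s) (γ t) ≤ C)
      ?_ ?_ ?_ (Set.mem_univ s) (Set.mem_univ t)
    · intro t _
      obtain ⟨C, J, hJ, h⟩ := hloc b t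
      rw [nhdsWithin_univ]
      filter_upwards [hJ] with s hs
      exact ⟨C, h.mono fun b' hb' γ hγ => hb' γ hγ t (mem_of_mem_nhds hJ) s hs⟩
    · rintro s t u - - - ⟨C, hC⟩ ⟨D, hD⟩
      refine ⟨C + D, ?_⟩
      filter_upwards [hC, hD] with b' h₁ h₂ γ hγ
      exact (dist_triangle _ (γ t) _).trans (add_le_add (h₁ γ hγ) (h₂ γ hγ))
    · rintro s t - - ⟨C, hC⟩
      exact ⟨C, hC.mono fun b' h γ hγ => (dist_comm _ _).trans_le (h γ hγ)⟩
  rcases isEmpty_or_nonempty T with hT | ⟨⟨t₀⟩⟩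
  · exact ⟨0, fun _ _ _ s => hT.elim s⟩
  have htrack (b : B) : ∃ C : ℝ, ∀ᶠ b' in 𝓝 b, ∀ γ, Lift b' γ →
      ∀ s ∈ Set.univ, dist (γ t₀) (γ s) ≤ C := by
    refine isCompact_univ.induction_on
      (p := fun A => ∃ C : ℝ, ∀ᶠ b' in 𝓝 b, ∀ γ, Lift b' γ → ∀ s ∈ A, dist (γ t₀) (γ s) ≤ C)
      ⟨0, by simp⟩ ?_ ?_ ?_
    · rintro A A' hA ⟨C, hC⟩
      exact ⟨C, hC.mono fun b' h γ hγ s hs => h γ hγ s (hA hs)⟩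
    · rintro A A' ⟨C, hC⟩ ⟨D, hD⟩
      refine ⟨max C D, ?_⟩
      filter_upwards [hC, hD] with b' h₁ h₂ γ hγ s hs
      exact hs.elim (fun h => le_max_of_le_left (h₁ γ hγ s h))
        (fun h => le_max_of_le_right (h₂ γ hγ s h))
    · intro t _
      obtain ⟨C, J, hJ, h⟩ := hloc b t
      obtain ⟨D, hD⟩ := hpair b t₀ t
      refine ⟨J, mem_nhdsWithin_of_mem_nhds hJ, D + C, ?_⟩
      filter_upwards [h, hD] with b' h₁ h₂ γ hγ s hs
      exact (dist_triangle _ (γ t) _).trans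
        (add_le_add (h₂ γ hγ) (h₁ γ hγ t (mem_of_mem_nhds hJ) s hs))
  obtain ⟨C, hC⟩ : ∃ C : ℝ, ∀ b ∈ Set.univ, ∀ γ, Lift b γ → ∀ s, dist (γ t₀) (γ s) ≤ C := by
    refine isCompact_univ.induction_on
      (p := fun A => ∃ C : ℝ, ∀ b ∈ A, ∀ γ, Lift b γ → ∀ s, dist (γ t₀) (γ s) ≤ C)
      ⟨0, by simp⟩ ?_ ?_ ?_
    · rintro A A' hA ⟨C, hC⟩
      exact ⟨C, fun b hb => hC b (hA hb)⟩
    · rintro A A' ⟨C, hC⟩ ⟨D, hD⟩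
      exact ⟨max C D, fun b hb γ hγ s => hb.elim (fun h => le_max_of_le_left (hC b h γ hγ s))
        (fun h => le_max_of_le_right (hD b h γ hγ s))⟩
    · intro b _
      obtain ⟨C, hC⟩ := htrack b
      exact ⟨_, mem_nhdsWithin_of_mem_nhds hC, C, fun b' h γ hγ s => h γ hγ s (Set.mem_univ s)⟩
  refine ⟨C + C, fun b γ hγ s s' => (dist_triangle_left _ _ (γ t₀)).trans ?_⟩
  exact add_le_add (hC b (Set.mem_univ b) γ hγ s) (hC b (Set.mem_univ b) γ hγ s')

/-- **A homotopy defined on the Stone–Čech compactification has uniformly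
bounded lifted tracks.**
`G` acts on a proper metric space `E` by isometries, freely and properly
discontinuously, with orbit map `p : E → X = E/G`.  For every topological
space `Z` and every continuous `Ĥ : βZ × [0,1] → X` there is a constant `C`
such that for every `z ∈ Z`, every lift `γ : [0,1] → E` of the track
`t ↦ Ĥ(η z, t)` satisfies `diam (γ([0,1])) ≤ C`. -/
theorem bounded_tracks_of_stoneCech_homotopy
    {G E : Type*} [Group G] [MetricSpace E] [ProperSpace E] [MulAction G E]
    (hiso : ∀ g : G, Isometry (fun x : E => g • x))
    (hfree : ∀ (g : G) (x : E), g • x = x → g = 1)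
    (hpd : ∀ x y : E, ∃ U ∈ nhds x, ∃ V ∈ nhds y,
      {g : G | ((g • U) ∩ V).Nonempty}.Finite)
    {Z : Type*} [TopologicalSpace Z]
    (Hhat : StoneCech Z × unitInterval → Quotient (MulAction.orbitRel G E))
    (hHhat : Continuous Hhat) :
    ∃ C : ℝ, ∀ (z : Z) (γ : C(unitInterval, E)),
      (∀ t : unitInterval,
        Quotient.mk (MulAction.orbitRel G E) (γ t) = Hhat (stoneCechUnit z, t)) →
      Metric.diam (Set.range γ) ≤ C := by
  have : LocallyConnectedSpace unitInterval :=
    (isQuotientMap_projIcc (h := zero_le_one' ℝ)).isCoinducing.locallyConnectedSpace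
  obtain ⟨C, hC⟩ := exists_dist_lift_le hiso hfree hpd hHhat
  refine ⟨C, fun z γ hγ => Metric.diam_le_of_forall_dist_le_of_nonempty (Set.range_nonempty γ) ?_⟩
  rintro _ ⟨s, rfl⟩ _ ⟨t, rfl⟩
  exact hC _ γ hγ s t
end
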